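/- arXiv:1109.1580 — 2 statements merged into one kernel-verified Lean document; each statement's English description precedes it below -/
import Mathlib

section
/- Let k be a field with a normalized discrete valuation v and let p be a prime number such that char k ≠ p and the unit group U_k is not contained in the set k^p of p-th powers of k. Then for every finite cyclic field extension K/k and every m ≥ 1 there exists an element a ∈ k such that the polynomial x^{p^m} − a is irreducible in k[x] and, for any root α of this polynomial, the fields K and k(α) are linearly disjoint over k. -/
open Polynomial IntermediateField

/-- A normalized discrete (additive) valuation on a field `k`: a surjective map
`k^× → ℤ` with `v(xy) = v(x) + v(y)` and `v(x+y) ≥ min (v x) (v y)`. -/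
structure IsNormalizedDiscreteValuation {k : Type*} [Field k] (v : k → ℤ) : Prop where
  surj : ∀ n : ℤ, ∃ x : k, x ≠ 0 ∧ v x = n
  map_mul : ∀ x y : k, x ≠ 0 → y ≠ 0 → v (x * y) = v x + v y
  min_le_map_add : ∀ x y : k, x ≠ 0 → y ≠ 0 → x + y ≠ 0 → min (v x) (v y) ≤ v (x + y)

/-- The even case of the irreducibility criterion for `X ^ (p ^ n) - a`. -/
theorem X_pow_two_pow_sub_C_irreducible (n : ℕ) :
    ∀ {F : Type*} [Field F], (2 : F) ≠ 0 → ∀ {a : F}, (∀ b : F, b ^ 2 ≠ a) →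
      (∀ b : F, b ^ 4 ≠ -4 * a) → Irreducible (X ^ 2 ^ n - C a) := by
  induction n with
  | zero => intro F _ _ a _ _; simpa using irreducible_X_sub_C a
  | succ n ih =>
    intro F _ h2 a ha ha'
    rw [pow_succ]
    refine X_pow_mul_sub_C_irreducible (X_pow_sub_C_irreducible_of_prime Nat.prime_two ha) ?_
    intro E _ _ x hx
    have hint : IsIntegral F x := by
      by_contra h
      have := congr_arg degree (hx.symm.trans (minpoly.eq_zero h))
      simp [degree_X_pow_sub_C (Nat.succ_pos 1)] at this
    set g := AdjoinSimple.gen F x with hg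
    have hg2 : g ^ 2 = algebraMap F F⟮x⟯ a := by
      have h := minpoly.aeval F g
      rw [hg, minpoly_gen, hx] at h
      simpa [sub_eq_zero] using h
    have h2' : (2 : F⟮x⟯) ≠ 0 := by
      rw [← map_ofNat (algebraMap F F⟮x⟯) 2]
      exact (_root_.map_ne_zero _).mpr h2
    have hgF : ∀ c : F, algebraMap F F⟮x⟯ c ≠ g := fun c hc ↦ ha c <|
      (algebraMap F F⟮x⟯).injective <| by rw [map_pow, hc, hg2]
    have key : ∀ (e : F), e ^ 2 = 1 → ∀ y : F⟮x⟯, y ^ 2 ≠ algebraMap F F⟮x⟯ e * g := by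
      intro e he y hy
      obtain ⟨f, hf, hyf⟩ := (adjoin.powerBasis hint).exists_eq_aeval y
      rw [adjoin.powerBasis_dim, hx, natDegree_X_pow_sub_C] at hf
      obtain ⟨t, s, rfl⟩ := exists_eq_X_add_C_of_natDegree_le_one (Nat.lt_succ_iff.mp hf)
      rw [adjoin.powerBasis_gen, ← hg] at hyf
      simp only [map_add, map_mul, aeval_C, aeval_X] at hyf
      have h1 : algebraMap F F⟮x⟯ (s ^ 2 + t ^ 2 * a) +
          algebraMap F F⟮x⟯ (2 * s * t - e) * g = 0 := by
        simp only [map_add, map_sub, map_mul, map_pow, map_ofNat, ← hg2]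
        linear_combination hy - (y + algebraMap F F⟮x⟯ t * g + algebraMap F F⟮x⟯ s) * hyf
      have hst : 2 * s * t - e = 0 := by
        by_contra h0
        refine hgF (-(s ^ 2 + t ^ 2 * a) / (2 * s * t - e)) ?_
        have h0' : algebraMap F F⟮x⟯ (2 * s * t - e) ≠ 0 := (_root_.map_ne_zero _).mpr h0
        rw [map_div₀, div_eq_iff h0', map_neg]
        linear_combination -h1
      rw [hst, map_zero, zero_mul, add_zero, map_eq_zero] at h1
      have ht : t ≠ 0 := by
        rintro rfl
        have : e = 0 := by linear_combination -hst
        simp [this] at he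
      refine ha' t⁻¹ ?_
      field_simp
      linear_combination 4 * t ^ 2 * h1 - (2 * s * t + e) * hst - he
    refine ih h2' (fun b hb ↦ key 1 (by simp) b (by simpa using hb)) fun b hb ↦ ?_
    refine key (-1) (by simp) (b ^ 2 / 2) ?_
    rw [div_pow, ← pow_mul, hb, map_neg, map_one]
    field_simp
    ring

/-- If `-a` is not a square in `F` and `a` is not a square in the Galois extension `K`, then
`-4 a` is not a fourth power in `K`. -/
theorem pow_four_ne_neg_four_mul {F K : Type*} [Field F] [Field K] [Algebra F K] [IsGalois F K]
    (h2 : (2 : F) ≠ 0) {a : F} (ha : ∀ b : F, b ^ 2 ≠ -a)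
    (haK : ∀ b : K, b ^ 2 ≠ algebraMap F K a) (c : K) : c ^ 4 ≠ -4 * algebraMap F K a := by
  intro hc
  have h2K : (2 : K) ≠ 0 := by
    rw [← map_ofNat (algebraMap F K) 2]
    exact (_root_.map_ne_zero _).mpr h2
  set w := c ^ 2 / 2 with hw
  have hw2 : w ^ 2 = -algebraMap F K a := by
    rw [hw, div_pow, ← pow_mul, hc]; field_simp; ring
  have hwF : w ∉ Set.range (algebraMap F K) := by
    rintro ⟨b, hb⟩
    refine ha b ((algebraMap F K).injective ?_)
    rw [map_pow, hb, hw2, map_neg]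
  rw [InfiniteGalois.mem_range_algebraMap_iff_fixed] at hwF
  push Not at hwF
  obtain ⟨σ, hσ⟩ := hwF
  have hσw : σ w = -w := by
    have : σ w ^ 2 = w ^ 2 := by rw [← map_pow, hw2, map_neg, σ.commutes]
    exact (sq_eq_sq_iff_eq_or_eq_neg.mp this).resolve_left hσ
  have hc0 : c ≠ 0 := by
    rintro rfl
    simp [hw] at hσ
  have hσc : σ c ^ 2 = -c ^ 2 := by
    have h : c ^ 2 = w * 2 := by rw [hw]; field_simp
    rw [← map_pow, h, map_mul, hσw, map_ofNat]; ring
  refine haK (σ c / c * w) ?_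
  rw [mul_pow, div_pow, hσc, hw2]
  field_simp

/-- In a finite Galois extension with commutative Galois group, a `p`-th root of unity which is a
quotient of conjugates of a `p`-th root of a non-`p`-th power lies in the base field. -/
theorem div_mem_range_algebraMap_of_pow_eq {F K : Type*} [Field F] [Field K] [Algebra F K]
    [FiniteDimensional F K] [IsGalois F K] [IsCyclic (K ≃ₐ[F] K)] {p : ℕ} (hp : p.Prime)
    {a : F} (ha : ∀ b : F, b ^ p ≠ a) {b : K} (hb : b ^ p = algebraMap F K a)
    (σ : K ≃ₐ[F] K) : σ b / b ∈ Set.range (algebraMap F K) := by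
  have hb0 : b ≠ 0 := by
    rintro rfl
    refine ha 0 ((algebraMap F K).injective ?_)
    rw [map_pow, map_zero, hb]
  have hint : IsIntegral F b := Algebra.IsIntegral.isIntegral b
  have hdeg : Module.finrank F F⟮b⟯ = p := by
    rw [adjoin.finrank hint, ← minpoly.eq_of_irreducible_of_monic
      (X_pow_sub_C_irreducible_of_prime hp ha) (by simp [hb]) (monic_X_pow_sub_C a hp.ne_zero),
      natDegree_X_pow_sub_C]
  have hbmem : b ∈ F⟮b⟯ := mem_adjoin_simple_self F b
  have hσb : σ b ∈ F⟮b⟯ := by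
    rw [← IsGalois.fixedField_fixingSubgroup F⟮b⟯]
    rintro ⟨τ, hτ⟩
    have hτb : τ b = b := (mem_fixingSubgroup_iff _ τ).mp hτ b hbmem
    have hcomm : τ * σ = σ * τ := IsCyclic.commGroup.mul_comm τ σ
    have := DFunLike.congr_fun hcomm b
    simp only [AlgEquiv.mul_apply, hτb] at this
    exact this
  set z := σ b / b with hz
  have hzp : z ^ p = 1 := by
    rw [hz, div_pow, ← map_pow, hb, σ.commutes, div_self]
    rw [← hb]; exact pow_ne_zero _ hb0
  by_cases hz1 : z = 1
  · exact ⟨1, by simp [hz1]⟩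
  have hle : F⟮z⟯ ≤ F⟮b⟯ := adjoin_simple_le_iff.mpr (div_mem hσb hbmem)
  have hdvd : Module.finrank F F⟮z⟯ ∣ p := hdeg ▸ finrank_dvd_of_le_right hle
  have hlt : Module.finrank F F⟮z⟯ < p := by
    rw [adjoin.finrank (Algebra.IsIntegral.isIntegral z)]
    have h0 : (∑ i ∈ Finset.range p, (X : F[X]) ^ i) ≠ 0 :=
      (Monic.geom_sum monic_X (by simp) hp.ne_zero).ne_zero
    have hroot : aeval z (∑ i ∈ Finset.range p, (X : F[X]) ^ i) = 0 := by
      simp only [map_sum, map_pow, aeval_X]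
      have := geom_sum_mul z p
      rw [hzp, sub_self] at this
      exact (mul_eq_zero.mp this).resolve_right (sub_ne_zero.mpr hz1)
    refine (natDegree_le_of_dvd (minpoly.dvd F z hroot) h0).trans_lt ?_
    refine (natDegree_sum_le_of_forall_le (n := p - 1) _ _ fun i hi ↦ ?_).trans_lt
      (Nat.sub_lt hp.pos one_pos)
    rw [natDegree_X_pow]
    exact Nat.le_sub_one_of_lt (Finset.mem_range.mp hi)
  have h1 := ((Nat.dvd_prime hp).mp hdvd).resolve_right hlt.ne
  rw [finrank_adjoin_simple_eq_one_iff] at h1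
  exact IntermediateField.mem_bot.mp h1

/-- Kummer theory for a cyclic extension: among elements acquiring a `p`-th root, all are powers
of a single one modulo `p`-th powers. -/
theorem exists_eq_pow_mul_pow_of_isCyclic {F K : Type*} [Field F] [Field K] [Algebra F K]
    [FiniteDimensional F K] [IsGalois F K] [IsCyclic (K ≃ₐ[F] K)] {p : ℕ} (hp : p.Prime)
    {a u : F} (ha : ∀ b : F, b ^ p ≠ a) (hu : ∀ b : F, b ^ p ≠ u) {b c : K}
    (hb : b ^ p = algebraMap F K a) (hc : c ^ p = algebraMap F K u) :
    ∃ (j : ℕ) (e : F), u = e ^ p * a ^ j := by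
  have hne : ∀ {a : F} {b : K}, (∀ b : F, b ^ p ≠ a) → b ^ p = algebraMap F K a → b ≠ 0 := by
    rintro a _ ha hb rfl
    refine ha 0 ((algebraMap F K).injective ?_)
    rw [map_pow, map_zero, hb]
  have hb0 : b ≠ 0 := hne ha hb
  have hc0 : c ≠ 0 := hne hu hc
  obtain ⟨σ, hσ⟩ := IsCyclic.exists_generator (α := K ≃ₐ[F] K)
  have hfix : ∀ x : K, σ x = x → x ∈ Set.range (algebraMap F K) := by
    intro x hx
    rw [IsGalois.mem_range_algebraMap_iff_fixed]
    intro τ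
    have hmem : σ ∈ MulAction.stabilizer (K ≃ₐ[F] K) x := hx
    exact (Subgroup.zpowers_le.mpr hmem) (hσ τ)
  have hroot : ∀ {a : F} {b : K}, b ≠ 0 → b ^ p = algebraMap F K a → (σ b / b) ^ p = 1 := by
    intro a b hb0 hb
    rw [div_pow, ← map_pow, hb, σ.commutes, div_self]
    rw [← hb]; exact pow_ne_zero _ hb0
  obtain ⟨z, hz⟩ := div_mem_range_algebraMap_of_pow_eq hp ha hb σ
  have hzb : (σ b / b) ≠ 1 := by
    intro h
    obtain ⟨d, rfl⟩ := hfix b ((div_eq_one_iff_eq hb0).mp h)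
    exact ha d ((algebraMap F K).injective (by rw [map_pow, hb]))
  have hprim : IsPrimitiveRoot (σ b / b) p := by
    have := Fact.mk hp
    rw [← orderOf_eq_prime (hroot hb0 hb) hzb]
    exact IsPrimitiveRoot.orderOf _
  have : NeZero p := ⟨hp.ne_zero⟩
  obtain ⟨j, -, hj⟩ := hprim.eq_pow_of_pow_eq_one (hroot hc0 hc)
  have hσc : σ c = (σ c / c) * c := by field_simp
  have hσb0 : σ b ≠ 0 := by simpa using hb0
  obtain ⟨e, he⟩ := hfix (c / b ^ j) (by
    rw [map_div₀, map_pow, hσc, ← hj, div_pow]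
    field_simp)
  refine ⟨j, e, (algebraMap F K).injective ?_⟩
  rw [map_mul, map_pow, map_pow, he, ← hb, ← hc, div_pow, ← pow_mul, ← pow_mul, mul_comm j p]
  field_simp

/-- If `X ^ n - a` stays irreducible over `K`, then `F(a^{1/n})` and `K` are linearly disjoint. -/
theorem linearDisjoint_adjoin_of_irreducible {F K Ω : Type*} [Field F] [Field K] [Algebra F K]
    [Field Ω] [Algebra F Ω] [Algebra K Ω] [IsScalarTower F K Ω] {n : ℕ} (hn : n ≠ 0) {a : F}
    (hF : Irreducible (X ^ n - C a)) (hK : Irreducible (X ^ n - C (algebraMap F K a)))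
    {α : Ω} (hα : α ^ n = algebraMap F Ω a) : (adjoin F {α}).LinearDisjoint K := by
  have hmF := minpoly.eq_of_irreducible_of_monic hF (x := α) (by simp [hα])
    (monic_X_pow_sub_C a hn)
  have hmK := minpoly.eq_of_irreducible_of_monic hK (x := α)
    (by simp [hα, ← IsScalarTower.algebraMap_apply]) (monic_X_pow_sub_C _ hn)
  have hint : IsIntegral F α := ⟨X ^ n - C a, monic_X_pow_sub_C a hn, by simp [hα]⟩
  have hli := linearIndependent_pow (K := K) α
  refine LinearDisjoint.of_basis_left (adjoin.powerBasis hint).basis ?_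
  have hd : (adjoin.powerBasis hint).dim = (minpoly K α).natDegree := by
    rw [adjoin.powerBasis_dim, ← hmF, ← hmK, natDegree_X_pow_sub_C, natDegree_X_pow_sub_C]
  convert hli.comp (Fin.cast hd) (Fin.cast_injective hd) using 1
  ext i
  simp

namespace IsNormalizedDiscreteValuation

variable {k : Type*} [Field k] {v : k → ℤ}

theorem map_one (hv : IsNormalizedDiscreteValuation v) : v 1 = 0 := by
  have := hv.map_mul 1 1 one_ne_zero one_ne_zero
  rw [one_mul] at this
  lia

theorem map_pow (hv : IsNormalizedDiscreteValuation v) {x : k} (hx : x ≠ 0) (n : ℕ) :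
    v (x ^ n) = n * v x := by
  induction n with
  | zero => simp [hv.map_one]
  | succ n ih =>
    rw [pow_succ, hv.map_mul _ _ (pow_ne_zero _ hx) hx, ih]
    push_cast
    ring

theorem map_neg (hv : IsNormalizedDiscreteValuation v) {x : k} (hx : x ≠ 0) : v (-x) = v x := by
  have h1 := hv.map_pow (neg_ne_zero.mpr hx) 2
  rw [neg_sq, hv.map_pow hx] at h1
  push_cast at h1
  lia

theorem pow_ne (hv : IsNormalizedDiscreteValuation v) {p : ℕ} (hp : p.Prime) {a : k}
    (ha : a ≠ 0) (hva : v a = 1) (b : k) : b ^ p ≠ a := by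
  rintro rfl
  have hb : b ≠ 0 := by
    rintro rfl
    simp [hp.ne_zero] at ha
  rw [hv.map_pow hb] at hva
  have : (p : ℤ) ∣ 1 := ⟨v b, hva.symm⟩
  exact hp.one_lt.ne' (by exact_mod_cast Int.eq_one_of_dvd_one (by positivity) this)

/-- In a cyclic extension some element of valuation `1` does not acquire a `p`-th root. -/
theorem exists_map_eq_one_and_pow_ne (hv : IsNormalizedDiscreteValuation v) {p : ℕ} (hp : p.Prime)
    (hU : ∃ u : k, u ≠ 0 ∧ v u = 0 ∧ ∀ c : k, c ^ p ≠ u) (K : Type*) [Field K] [Algebra k K]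
    [FiniteDimensional k K] [IsGalois k K] [IsCyclic (K ≃ₐ[k] K)] :
    ∃ a : k, a ≠ 0 ∧ v a = 1 ∧ ∀ b : K, b ^ p ≠ algebraMap k K a := by
  obtain ⟨u, hu0, hvu, hu⟩ := hU
  obtain ⟨a, ha0, hva⟩ := hv.surj 1
  by_contra! hcon
  obtain ⟨b, hb⟩ := hcon a ha0 hva
  obtain ⟨d, hd⟩ := hcon (u * a) (mul_ne_zero hu0 ha0) (by rw [hv.map_mul _ _ hu0 ha0]; lia)
  have ha0' : algebraMap k K a ≠ 0 := by simpa using ha0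
  have hc : (d / b) ^ p = algebraMap k K u := by
    rw [div_pow, hd, hb, _root_.map_mul, mul_div_cancel_right₀ _ ha0']
  obtain ⟨j, e, he⟩ := exists_eq_pow_mul_pow_of_isCyclic hp (hv.pow_ne hp ha0 hva) hu hb hc
  have he0 : e ≠ 0 := by
    rintro rfl
    simp [hp.ne_zero] at he
    exact hu0 he
  have hval := congr_arg v he
  rw [hv.map_mul _ _ (pow_ne_zero _ he0) (pow_ne_zero _ ha0), hv.map_pow he0, hv.map_pow ha0,
    hvu, hva] at hval
  have hdvd : (p : ℤ) ∣ j := ⟨-v e, by linear_combination -hval⟩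
  obtain ⟨i, rfl⟩ := Int.natCast_dvd_natCast.mp hdvd
  refine hu (e * a ^ i) ?_
  rw [he, mul_pow, ← pow_mul, mul_comm i p]

end IsNormalizedDiscreteValuation

/-- Let `k` be a field with a normalized discrete valuation `v` and `p` a
prime with `char k ≠ p` such that the unit group `U_k` is not contained in `k^p`. Then for
every finite cyclic extension `K/k` and every `m ≥ 1` there exists `a ∈ k` such that
`x^(p^m) - a` is irreducible in `k[x]` and, for any root `α` of this polynomial (in any
common overfield `Ω` of `K` and `k`), the fields `K` and `k(α)` are linearly disjoint
over `k`. -/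
theorem stmt5 {k : Type*} [Field k] (v : k → ℤ) (hv : IsNormalizedDiscreteValuation v)
    (p : ℕ) (hp : p.Prime) (hchar : ringChar k ≠ p)
    (hU : ∃ u : k, u ≠ 0 ∧ v u = 0 ∧ ∀ c : k, c ^ p ≠ u)
    (K : Type*) [Field K] [Algebra k K] [FiniteDimensional k K]
    [IsGalois k K] [IsCyclic (K ≃ₐ[k] K)]
    (m : ℕ) (hm : 1 ≤ m) :
    ∃ a : k, Irreducible (X ^ p ^ m - C a) ∧
      ∀ (Ω : Type*) [Field Ω] [Algebra k Ω] [Algebra K Ω] [IsScalarTower k K Ω] (α : Ω),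
        α ^ p ^ m = algebraMap k Ω a →
        (adjoin k {α}).LinearDisjoint K := by
  obtain ⟨a, ha0, hva, haK⟩ := hv.exists_map_eq_one_and_pow_ne hp hU K
  have hK : Irreducible (X ^ p ^ m - C (algebraMap k K a)) := by
    by_cases hp2 : p = 2
    · subst hp2
      have h2 : (2 : k) ≠ 0 := Ring.two_ne_zero hchar
      have h2K : (2 : K) ≠ 0 := by
        rw [← map_ofNat (algebraMap k K) 2]
        exact (_root_.map_ne_zero _).mpr h2
      refine X_pow_two_pow_sub_C_irreducible m h2K haK ?_
      refine pow_four_ne_neg_four_mul h2 (hv.pow_ne hp (neg_ne_zero.mpr ha0) ?_) haK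
      rw [hv.map_neg ha0, hva]
    · exact X_pow_sub_C_irreducible_of_prime_pow hp hp2 m haK
  have hn : p ^ m ≠ 0 := pow_ne_zero _ hp.ne_zero
  have hk : Irreducible (X ^ p ^ m - C a) :=
    (monic_X_pow_sub_C a hn).irreducible_of_irreducible_map (algebraMap k K) _ (by simpa using hK)
  exact ⟨a, hk, fun Ω _ _ _ _ α hα ↦ linearDisjoint_adjoin_of_irreducible hn hk hK hα⟩
end

section
/- Let K/k be a cyclic extension of p-power degree of global fields with char k = p > 0, and let v_1, …, v_r ∈ Val(K) be pairwise different valuations on K. For any m ∈ ℕ there exists a field extension L ⊇ K with [L:K] = p^m such that L/k is cyclic and the local degree [L:K]_{v_i} equals p^m for i = 1, …, r (in particular each v_i extends uniquely to L). -/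
universe u

noncomputable section

/-- An absolute value on a field is non-archimedean if it satisfies the ultrametric
inequality. -/
def IsNonarchAV {K : Type*} [Field K] (v : AbsoluteValue K ℝ) : Prop :=
  ∀ x y : K, v (x + y) ≤ max (v x) (v y)

/-- A nontrivial absolute value (representing a place of a global field). -/
def IsNontrivialAV {K : Type*} [Field K] (v : AbsoluteValue K ℝ) : Prop :=
  ∃ x : K, x ≠ 0 ∧ v x ≠ 1

/-- Two absolute values are equivalent (define the same place) if one is a positive real
power of the other. -/
def EquivAV {K : Type*} [Field K] (v w : AbsoluteValue K ℝ) : Prop :=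
  ∃ c : ℝ, 0 < c ∧ ∀ x : K, w x = v x ^ c

/-- `w` (on the extension field `K`) extends `v` (on `k`). -/
def ExtendsAV {k K : Type*} [Field k] [Field K] [Algebra k K]
    (v : AbsoluteValue k ℝ) (w : AbsoluteValue K ℝ) : Prop :=
  ∀ x : k, w (algebraMap k K x) = v x

/-- `v` extends uniquely to a valuation on `K`. -/
def ExtendsUniquelyAV (k K : Type*) [Field k] [Field K] [Algebra k K]
    (v : AbsoluteValue k ℝ) : Prop :=
  (∃ w : AbsoluteValue K ℝ, ExtendsAV v w) ∧
    ∀ w w' : AbsoluteValue K ℝ, ExtendsAV v w → ExtendsAV v w' → w = w'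

/-- `k` is a global field: a number field, or a finite extension of a rational function
field over a finite field. -/
def IsGlobalField (k : Type u) [Field k] : Prop :=
  NumberField k ∨
    ∃ (Fq : Type u) (_ : Field Fq) (_ : Finite Fq) (_ : Algebra (RatFunc Fq) k),
      FiniteDimensional (RatFunc Fq) k

/-- The local degree of a finite Galois extension `L/K` at an absolute value `w` on `L`:
the order of the decomposition group of `w`. -/
def localDegreeGal (K : Type*) {L : Type*} [Field K] [Field L] [Algebra K L]
    (w : AbsoluteValue L ℝ) : ℕ :=
  Nat.card {σ : L ≃ₐ[K] L // ∀ x : L, w (σ x) = w x}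

open Polynomial

theorem AbsoluteValue.isNonarchimedean_of_charP {K : Type*} [Field K] (p : ℕ) [Fact p.Prime]
    [CharP K p] (v : AbsoluteValue K ℝ) : IsNonarchimedean v := by
  have h : ∀ n : ℕ, ‖(n : WithAbs v)‖ ≤ 1 := by
    intro n
    have hn : (n : K) ∈ (⊥ : Subfield K) := natCast_mem _ n
    rw [Subfield.mem_bot_iff_pow_eq_self K p] at hn
    have h1 : v (n : K) ^ p = v n := by rw [← map_pow, hn]
    by_contra! hlt
    have h2 : 1 < v (n : K) := hlt
    have := lt_self_pow₀ h2 (Fact.out : p.Prime).one_lt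
    linarith
  have := IsUltrametricDist.isUltrametricDist_of_forall_norm_natCast_le_one h
  intro x y
  exact IsUltrametricDist.norm_add_le_max (WithAbs.toAbs v x) (WithAbs.toAbs v y)

theorem exists_norm_sub_algebraMap_lt {F E : Type*} [Field F] [Field E] [Algebra F E]
    [FiniteDimensional F E] [IsGalois F E] (w : AbsoluteValue E ℝ) (hna : IsNonarchimedean w)
    (hw : w.IsNontrivial) (hst : ∀ σ : E ≃ₐ[F] E, (∀ x, w (σ x) = w x) → σ = 1)
    (x : E) {ε : ℝ} (hε : 0 < ε) : ∃ y : F, w (algebraMap F E y - x) < ε := by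
  classical
  let V : (E ≃ₐ[F] E) → AbsoluteValue E ℝ :=
    fun σ ↦ w.comp (f := (σ : E →+* E)) σ.injective
  have hV : ∀ σ x, V σ x = w (σ x) := fun _ _ ↦ rfl
  have hnt : ∀ σ, (V σ).IsNontrivial := fun σ ↦ by
    obtain ⟨x, hx, hx1⟩ := hw
    exact ⟨σ.symm x, by simpa using hx, by simpa [hV] using hx1⟩
  have hpair : Pairwise fun σ τ ↦ ¬ (V σ).IsEquiv (V τ) := by
    intro σ τ hne heq
    obtain ⟨c, hc, h⟩ := AbsoluteValue.isEquiv_iff_exists_rpow_eq.1 heq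
    have h1 : ∀ y, w ((τ * σ⁻¹) y) = w y ^ c := fun y ↦ by
      have h' : w (σ (σ⁻¹ y)) ^ c = w (τ (σ⁻¹ y)) := congrFun h (σ⁻¹ y)
      rw [AlgEquiv.mul_apply, ← h']
      congr 2
      exact σ.apply_symm_apply y
    have h2 : ∀ (n : ℕ) y, w (((τ * σ⁻¹) ^ n) y) = w y ^ (c ^ n) := by
      intro n
      induction n with
      | zero => simp
      | succ n ih =>
        intro y
        rw [pow_succ, AlgEquiv.mul_apply, ih, h1, ← Real.rpow_mul (w.nonneg _), pow_succ']
    have hc1 : c = 1 := by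
      obtain ⟨y, hy, hy1⟩ := hw
      have h3 := h2 (orderOf (τ * σ⁻¹)) y
      rw [pow_orderOf_eq_one] at h3
      have h4 : w y ^ (1 : ℝ) = w y ^ (c ^ orderOf (τ * σ⁻¹)) := by simpa using h3
      rw [Real.rpow_right_inj (w.pos hy) hy1] at h4
      exact (pow_eq_one_iff_of_nonneg hc.le (orderOf_pos _).ne').1 h4.symm
    have := hst (τ * σ⁻¹) fun y ↦ by simpa [hc1] using h1 y
    exact hne (mul_inv_eq_one.1 this).symm
  let z : (σ : E ≃ₐ[F] E) → WithAbs (V σ) :=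
    fun σ ↦ WithAbs.toAbs (V σ) (if σ = 1 then x else 0)
  obtain ⟨a, ha⟩ := Metric.denseRange_iff.1 (AbsoluteValue.denseRange_algebraMap_pi hnt hpair) z ε hε
  rw [dist_pi_lt_iff hε] at ha
  have ha' : ∀ σ : E ≃ₐ[F] E, w (σ (a - if σ = 1 then x else 0)) < ε := fun σ ↦ by
    have := ha σ
    rw [dist_comm, dist_eq_norm] at this
    exact this
  refine ⟨Algebra.trace F E a, ?_⟩
  have hsum : algebraMap F E (Algebra.trace F E a) - x
      = ∑ σ : E ≃ₐ[F] E, σ (a - if σ = 1 then x else 0) := by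
    simp only [map_sub, Finset.sum_sub_distrib, trace_eq_sum_automorphisms]
    congr 1
    rw [Finset.sum_eq_single 1] <;> simp +contextual
  rw [hsum]
  refine (hna.apply_sum_le_sup Finset.univ_nonempty).trans_lt ?_
  rw [Finset.sup'_lt_iff]
  exact fun σ _ ↦ ha' σ

theorem exists_extendsAV {K L : Type*} [Field K] [Field L] [Algebra K L] [Algebra.IsAlgebraic K L]
    (v : AbsoluteValue K ℝ) (hna : IsNonarchimedean v) (hv : v.IsNontrivial) :
    ∃ w : AbsoluteValue L ℝ, ExtendsAV v w := by
  obtain ⟨x, hx⟩ := hv.exists_abv_gt_one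
  let : NontriviallyNormedField v.Completion :=
    { (inferInstance : NormedField v.Completion) with
      non_trivial := ⟨(WithAbs.toAbs v x : v.Completion), by
        rw [UniformSpace.Completion.norm_coe]; exact hx⟩ }
  have hu : IsUltrametricDist (WithAbs v) :=
    IsUltrametricDist.isUltrametricDist_of_isNonarchimedean_norm fun x y ↦ hna x.ofAbs y.ofAbs
  have hu' : IsUltrametricDist v.Completion :=
    IsUltrametricDist.isUltrametricDist_of_forall_norm_natCast_le_one fun n ↦ by
      have := IsUltrametricDist.norm_natCast_le_one (WithAbs v) n
      rw [← UniformSpace.Completion.norm_coe] at this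
      rwa [← map_natCast (UniformSpace.Completion.coeRingHom (α := WithAbs v)) n]
  let i : K →+* v.Completion :=
    UniformSpace.Completion.coeRingHom.comp (WithAbs.equiv v).symm.toRingHom
  let j : K →+* AlgebraicClosure v.Completion := (algebraMap v.Completion _).comp i
  let := j.toAlgebra
  let f : L →ₐ[K] AlgebraicClosure v.Completion := IsAlgClosed.lift
  let N := spectralMulAlgNorm v.Completion (AlgebraicClosure v.Completion)
  have hN : ∀ y : v.Completion, N (algebraMap _ _ y) = ‖y‖ := spectralAlgNorm_extends
  refine ⟨{ toFun := fun x ↦ N (f x)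
            map_mul' := fun x y ↦ by simp
            nonneg' := fun x ↦ apply_nonneg N _
            eq_zero' := fun x ↦ by simp
            add_le' := fun x y ↦ by simpa using map_add_le_add N (f x) (f y) }, fun y ↦ ?_⟩
  change N (f (algebraMap K L y)) = v y
  rw [f.commutes]
  change N (algebraMap _ _ (i y)) = v y
  rw [hN]
  exact UniformSpace.Completion.norm_coe _

theorem ExtendsAV.isNontrivial {K L : Type*} [Field K] [Field L] [Algebra K L]
    {v : AbsoluteValue K ℝ} {w : AbsoluteValue L ℝ} (h : ExtendsAV v w) (hv : v.IsNontrivial) :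
    w.IsNontrivial := by
  obtain ⟨x, hx, hx1⟩ := hv
  exact ⟨algebraMap K L x, by simpa using hx, by rwa [h x]⟩

theorem eq_of_extendsAV_of_forall_apply_eq {F E : Type*} [Field F] [Field E] [Algebra F E]
    [FiniteDimensional F E] [IsGalois F E] {v : AbsoluteValue F ℝ} {w w' : AbsoluteValue E ℝ}
    (h : ExtendsAV v w) (h' : ExtendsAV v w') (hs : ∀ (σ : E ≃ₐ[F] E) x, w (σ x) = w x)
    (hs' : ∀ (σ : E ≃ₐ[F] E) x, w' (σ x) = w' x) : w = w' := by
  ext x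
  have key : ∀ u : AbsoluteValue E ℝ, ExtendsAV v u → (∀ (σ : E ≃ₐ[F] E) x, u (σ x) = u x) →
      u x ^ Nat.card (E ≃ₐ[F] E) = v (Algebra.norm F x) := by
    intro u hu hus
    rw [← hu, Algebra.norm_eq_prod_automorphisms, map_prod]
    simp [hus]
  exact (pow_left_inj₀ (w.nonneg x) (w'.nonneg x) Nat.card_pos.ne').1
    ((key w h hs).trans (key w' h' hs').symm)

theorem IsCyclic.mem_of_pow_prime_eq_one {G : Type*} [Group G] [Finite G] [IsCyclic G] {p e : ℕ}
    (hp : p.Prime) (hG : Nat.card G = p ^ e) {D : Subgroup G} (hD : D ≠ ⊥) {σ : G}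
    (hσ : σ ^ p = 1) : σ ∈ D := by
  classical
  have := Fintype.ofFinite G
  have := Fact.mk hp
  have hdvd : p ∣ Nat.card D := by
    obtain ⟨f, -, hf⟩ := (Nat.dvd_prime_pow hp).1 (hG ▸ D.card_subgroup_dvd_card)
    rw [hf]
    refine dvd_pow_self p ?_
    rintro rfl
    exact hD (Subgroup.eq_bot_of_card_eq _ (by simpa using hf))
  obtain ⟨d, hd⟩ := exists_prime_orderOf_dvd_card' p hdvd
  have hd' : orderOf (d : G) = p := by simpa using hd
  have hsub : (Subgroup.zpowers (d : G) : Set G).toFinset ⊆ Finset.univ.filter (· ^ p = 1) := by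
    intro x hx
    simp only [Set.mem_toFinset, SetLike.mem_coe] at hx
    obtain ⟨n, rfl⟩ := hx
    simp only [Finset.mem_filter, Finset.mem_univ, true_and]
    rw [← zpow_natCast, ← zpow_mul, mul_comm, zpow_mul, zpow_natCast, ← hd', pow_orderOf_eq_one,
      one_zpow]
  have hcard := Finset.eq_of_subset_of_card_le hsub (by
    refine (IsCyclic.card_pow_eq_one_le hp.pos).trans ?_
    rw [Set.toFinset_card, ← Nat.card_eq_fintype_card]
    exact (hd'.symm.trans (Nat.card_zpowers _).symm).le)
  have : σ ∈ (Subgroup.zpowers (d : G) : Set G).toFinset := by rw [hcard]; simpa using hσ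
  rw [Set.mem_toFinset] at this
  exact (Subgroup.zpowers_le.2 d.2) this

/-- Elements of `Gal(L/K)` fix `w` as soon as the decomposition group of `w` in the cyclic
`p`-group `Gal(L/k)` is nontrivial. -/
theorem apply_eq_of_exists_ne_one {k K L : Type*} [Field k] [Field K] [Field L] [Algebra k K]
    [Algebra k L] [Algebra K L] [IsScalarTower k K L] [FiniteDimensional k L] [IsGalois k L]
    [IsCyclic (L ≃ₐ[k] L)] {p e : ℕ} (hp : p.Prime) (hdeg : Module.finrank k L = p ^ e)
    (hKL : Module.finrank K L = p) (w : AbsoluteValue L ℝ)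
    (hw : ∃ σ : L ≃ₐ[k] L, (∀ x, w (σ x) = w x) ∧ σ ≠ 1) (σ : L ≃ₐ[K] L) (x : L) :
    w (σ x) = w x := by
  have : FiniteDimensional K L := FiniteDimensional.right k K L
  have : IsGalois K L := IsGalois.tower_top_of_isGalois k K L
  let D : Subgroup (L ≃ₐ[k] L) :=
    { carrier := {σ | ∀ x, w (σ x) = w x}
      one_mem' := fun x ↦ rfl
      mul_mem' := fun {a b} ha hb x ↦ by rw [AlgEquiv.mul_apply, ha, hb]
      inv_mem' := fun {a} ha x ↦ by
        rw [← ha (a⁻¹ x), ← AlgEquiv.mul_apply, mul_inv_cancel, AlgEquiv.one_apply] }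
  have hD : D ≠ ⊥ := by
    obtain ⟨τ, hτ, hτ1⟩ := hw
    exact fun h ↦ hτ1 ((Subgroup.eq_bot_iff_forall _).1 h τ hτ)
  have hpow : σ ^ p = 1 := by
    rw [← hKL, ← IsGalois.card_aut_eq_finrank K L, pow_card_eq_one']
  have hpow' : (σ.restrictScalars k) ^ p = 1 := by
    have : ∀ n : ℕ, (σ.restrictScalars k) ^ n = (σ ^ n).restrictScalars k := fun n ↦ by
      induction n with
      | zero => rfl
      | succ n ih => rw [pow_succ, ih, pow_succ]; rfl
    rw [this, hpow]
    rfl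
  exact IsCyclic.mem_of_pow_prime_eq_one hp
    ((IsGalois.card_aut_eq_finrank k L).trans hdeg) hD hpow' x

theorem artinSchreier_monic_natDegree {K : Type*} [Field K] {p : ℕ} (hp : 1 < p) (β : K) :
    (X ^ p - X - C β : K[X]).Monic ∧ (X ^ p - X - C β : K[X]).natDegree = p := by
  have h : (X ^ p - X - C β : K[X]) = X ^ p - (X + C β) := by ring
  have hdeg : (X + C β : K[X]).degree < p := by
    rw [degree_X_add_C]
    exact_mod_cast hp
  rw [h]
  refine ⟨monic_X_pow_sub hdeg, ?_⟩
  rw [natDegree_sub_eq_left_of_natDegree_lt, natDegree_X_pow]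
  rwa [natDegree_X_pow, natDegree_X_add_C]

theorem irreducible_artinSchreier {K : Type*} [Field K] (p : ℕ) [Fact p.Prime] [CharP K p] {β : K}
    (hβ : ∀ y : K, y ^ p - y ≠ β) : Irreducible (X ^ p - X - C β : K[X]) := by
  have hp : p.Prime := Fact.out
  obtain ⟨hmon, hdeg⟩ := artinSchreier_monic_natDegree hp.one_lt β
  set f : K[X] := X ^ p - X - C β with hf
  let E := AlgebraicClosure K
  have : CharP E p := charP_of_injective_algebraMap (algebraMap K E).injective p
  obtain ⟨θ, hθ⟩ := IsAlgClosed.exists_aeval_eq_zero E f (by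
    rw [degree_eq_natDegree hmon.ne_zero, hdeg]; exact_mod_cast hp.ne_zero)
  have hθ' : θ ^ p - θ = algebraMap K E β := by simpa [hf, sub_eq_zero] using hθ
  have hint : IsIntegral K θ := ⟨f, hmon, by rwa [← aeval_def]⟩
  set g := minpoly K θ with hg
  have hgf : g ∣ f := minpoly.dvd K θ hθ
  have hgm : g.Monic := minpoly.monic hint
  have hle : g.natDegree ≤ p := hdeg ▸ natDegree_le_of_dvd hgf hmon.ne_zero
  rcases hle.eq_or_lt with heq | hlt
  · rw [eq_of_monic_of_dvd_of_natDegree_le hgm hmon hgf (by rw [heq, hdeg])]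
    exact minpoly.irreducible hint
  exfalso
  have hsp : (g.map (algebraMap K E)).Splits := IsAlgClosed.splits _
  have hroots : ∀ r ∈ (g.map (algebraMap K E)).roots, r - θ ∈ (⊥ : Subfield E) := by
    intro r hr
    rw [mem_roots (hgm.map _).ne_zero, IsRoot, eval_map_algebraMap] at hr
    have hr' : aeval r f = 0 := by
      obtain ⟨q, hq⟩ := hgf
      rw [hq, map_mul, hr, zero_mul]
    have hr'' : r ^ p - r = algebraMap K E β := by simpa [hf, sub_eq_zero] using hr'
    rw [Subfield.mem_bot_iff_pow_eq_self E p, sub_pow_char]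
    linear_combination hr'' - hθ'
  have hsum := hsp.nextCoeff_eq_neg_sum_roots_of_monic (hgm.map _)
  have hsum2 : (g.map (algebraMap K E)).roots.sum
      = (g.natDegree : E) * θ + ((g.map (algebraMap K E)).roots.map (· - θ)).sum := by
    rw [Multiset.sum_map_sub, Multiset.map_id', Multiset.map_const', Multiset.sum_replicate,
      ← hsp.natDegree_eq_card_roots, natDegree_map, nsmul_eq_mul]
    ring
  have hmem : ((g.map (algebraMap K E)).roots.map (· - θ)).sum ∈ (⊥ : Subfield E) :=
    multiset_sum_mem _ fun x hx ↦ by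
      obtain ⟨r, hr, rfl⟩ := Multiset.mem_map.1 hx
      exact hroots r hr
  have hbot : (⊥ : Subfield E) ≤ (algebraMap K E).fieldRange := bot_le
  have hnext : (g.map (algebraMap K E)).nextCoeff ∈ (algebraMap K E).fieldRange := by
    rw [nextCoeff_map (algebraMap K E).injective]
    exact ⟨_, rfl⟩
  have hd0 : (g.natDegree : E) ≠ 0 := by
    rw [Ne, CharP.cast_eq_zero_iff E p]
    exact fun h ↦ hlt.not_ge (Nat.le_of_dvd (minpoly.natDegree_pos hint) h)
  have hθmem : θ ∈ (algebraMap K E).fieldRange := by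
    have h1 : (g.natDegree : E) * θ ∈ (algebraMap K E).fieldRange := by
      have : (g.natDegree : E) * θ = -(g.map (algebraMap K E)).nextCoeff -
          ((g.map (algebraMap K E)).roots.map (· - θ)).sum := by
        rw [hsum, hsum2]; ring
      rw [this]
      exact sub_mem (neg_mem hnext) (hbot hmem)
    have h2 := mul_mem (inv_mem (natCast_mem (algebraMap K E).fieldRange g.natDegree)) h1
    rwa [inv_mul_cancel_left₀ hd0] at h2
  obtain ⟨y, rfl⟩ := hθmem
  refine hβ y ((algebraMap K E).injective ?_)
  simpa using hθ'

theorem sum_range_pow_apply_eq_trace {k K : Type*} [Field k] [Field K] [Algebra k K]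
    [FiniteDimensional k K] [IsGalois k K] {σ : K ≃ₐ[k] K} (hσ : ∀ τ, τ ∈ Subgroup.zpowers σ)
    (a : K) : ∑ i ∈ Finset.range (Module.finrank k K), (σ ^ i) a
      = algebraMap k K (Algebra.trace k K a) := by
  classical
  have hcard : orderOf σ = Module.finrank k K := by
    rw [← IsGalois.card_aut_eq_finrank, orderOf_eq_card_of_forall_mem_zpowers hσ]
  rw [trace_eq_sum_automorphisms, ← IsCyclic.image_range_orderOf hσ, Finset.sum_image, hcard]
  intro i hi j hj hij
  exact pow_injOn_Iio_orderOf (by simpa using hi) (by simpa using hj) hij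

theorem exists_trace_eq_one_of_cyclic {k K : Type*} [Field k] [Field K] [Algebra k K]
    [FiniteDimensional k K] [IsGalois k K] {σ : K ≃ₐ[k] K} (hσ : ∀ τ, τ ∈ Subgroup.zpowers σ)
    (p : ℕ) [Fact p.Prime] [CharP k p] :
    ∃ a b : K, Algebra.trace k K a = 1 ∧ σ b - b = a ^ p - a := by
  have : CharP K p := charP_of_injective_algebraMap (algebraMap k K).injective p
  obtain ⟨a, ha⟩ := Algebra.trace_surjective k K 1
  have htr := sum_range_pow_apply_eq_trace hσ a
  set n := Module.finrank k K with hn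
  rw [ha, map_one] at htr
  have hσn : σ ^ n = 1 := by
    rw [hn, ← IsGalois.card_aut_eq_finrank, pow_card_eq_one']
  let S : ℕ → K := fun i ↦ ∑ j ∈ Finset.range i, (σ ^ j) (a ^ p - a)
  have hS : ∀ i, σ (S i) = S (i + 1) - (a ^ p - a) := fun i ↦ by
    simp only [S, map_sum]
    rw [Finset.sum_range_succ']
    simp [pow_succ']
  have hSn : S n = 0 := by
    have : S n = (∑ j ∈ Finset.range n, (σ ^ j) a) ^ p - ∑ j ∈ Finset.range n, (σ ^ j) a := by
      simp [S, sum_pow_char]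
    rw [this, htr]
    simp
  refine ⟨a, -∑ i ∈ Finset.range n, S i * (σ ^ i) a, ha, ?_⟩
  have h1 : σ (∑ i ∈ Finset.range n, S i * (σ ^ i) a)
      = ∑ i ∈ Finset.range n, (S (i + 1) - (a ^ p - a)) * (σ ^ (i + 1)) a := by
    simp only [map_sum, map_mul, hS, pow_succ', AlgEquiv.mul_apply]
  have h2 := Finset.sum_range_succ' (fun i ↦ S i * (σ ^ i) a) n
  rw [Finset.sum_range_succ, hSn] at h2
  have h3 := Finset.sum_range_succ' (fun i ↦ (σ ^ i) a) n
  rw [Finset.sum_range_succ, htr, hσn] at h3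
  have h4 : S 0 = 0 := by simp [S]
  rw [h4] at h2
  rw [map_neg, h1]
  simp only [sub_mul, Finset.sum_sub_distrib, ← Finset.mul_sum]
  simp only [pow_zero, zero_mul, add_zero] at h2 h3
  rw [← h2, ← add_right_cancel h3]
  ring

theorem exists_cyclic_artinSchreier {k K : Type u} [Field k] [Field K] [Algebra k K]
    [FiniteDimensional k K] [IsGalois k K] {σ : K ≃ₐ[k] K} (hσ : ∀ τ, τ ∈ Subgroup.zpowers σ)
    (p : ℕ) [Fact p.Prime] [CharP k p] {e : ℕ} (hdeg : Module.finrank k K = p ^ e)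
    {a β : K} (ha : Algebra.trace k K a = 1) (hβ : σ β - β = a ^ p - a)
    (hroot : ∀ y : K, y ^ p - y ≠ β) :
    ∃ (L : Type u) (_ : Field L) (_ : Algebra k L) (_ : Algebra K L) (_ : IsScalarTower k K L),
      Module.finrank K L = p ∧ IsGalois k L ∧ IsCyclic (L ≃ₐ[k] L) ∧
      ∃ θ : L, θ ^ p - θ = algebraMap K L β := by
  have hp : p.Prime := Fact.out
  have : CharP K p := charP_of_injective_algebraMap (algebraMap k K).injective p
  have hirr := irreducible_artinSchreier p hroot
  obtain ⟨hmon, hnd⟩ := artinSchreier_monic_natDegree hp.one_lt β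
  set f : K[X] := X ^ p - X - C β with hf
  have := Fact.mk hirr
  let L := AdjoinRoot f
  have : CharP L p := charP_of_injective_algebraMap (algebraMap K L).injective p
  let θ : L := AdjoinRoot.root f
  have hθ : θ ^ p - θ = algebraMap K L β := by
    have h := AdjoinRoot.eval₂_root f
    rw [hf, eval₂_sub, eval₂_sub, eval₂_pow, eval₂_X, eval₂_C, sub_eq_zero] at h
    exact h
  have hfinK : FiniteDimensional K L := (AdjoinRoot.powerBasis hirr.ne_zero).finite
  have hfin : FiniteDimensional k L := FiniteDimensional.trans k K L
  have hKL : Module.finrank K L = p := by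
    rw [(AdjoinRoot.powerBasis hirr.ne_zero).finrank, AdjoinRoot.powerBasis_dim, hnd]
  have hkL : Module.finrank k L = p ^ (e + 1) := by
    rw [← Module.finrank_mul_finrank k K L, hdeg, hKL, pow_succ]
  let i : K →ₐ[k] L := (IsScalarTower.toAlgHom k K L).comp (σ : K →ₐ[k] K)
  have hi : ∀ y, i y = algebraMap K L (σ y) := fun y ↦ rfl
  have hev : eval₂ (i : K →+* L) (θ + algebraMap K L a) f = 0 := by
    simp only [hf, eval₂_sub, eval₂_pow, eval₂_X, eval₂_C, add_pow_char]
    change _ - i β = 0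
    have h := congrArg (algebraMap K L) hβ
    rw [map_sub, map_sub, map_pow] at h
    rw [hi]
    linear_combination hθ - h
  let s₀ : L →ₐ[k] L := AdjoinRoot.liftAlgHom f i (θ + algebraMap K L a) hev
  let s : L ≃ₐ[k] L := AlgEquiv.ofBijective s₀ s₀.bijective
  have hsK : ∀ y : K, s (algebraMap K L y) = algebraMap K L (σ y) := fun y ↦
    AdjoinRoot.liftAlgHom_of f i _ hev y
  have hsθ : s θ = θ + algebraMap K L a := AdjoinRoot.liftAlgHom_root f i _ hev
  have hsK' : ∀ (n : ℕ) (y : K), (s ^ n) (algebraMap K L y) = algebraMap K L ((σ ^ n) y) := by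
    intro n
    induction n with
    | zero => simp
    | succ n ih => intro y; rw [pow_succ, AlgEquiv.mul_apply, hsK, ih, pow_succ]; rfl
  have hsθ' : ∀ n : ℕ, (s ^ n) θ = θ + algebraMap K L (∑ i ∈ Finset.range n, (σ ^ i) a) := by
    intro n
    induction n with
    | zero => simp
    | succ n ih =>
      rw [pow_succ, AlgEquiv.mul_apply, hsθ, map_add, ih, hsK', Finset.sum_range_succ, map_add,
        add_assoc]
  have hρθ : (s ^ p ^ e) θ = θ + 1 := by
    rw [hsθ', ← hdeg, sum_range_pow_apply_eq_trace hσ, ha, map_one, map_one]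
  have hρK : ∀ y : K, (s ^ p ^ e) (algebraMap K L y) = algebraMap K L y := fun y ↦ by
    rw [hsK', ← hdeg, ← IsGalois.card_aut_eq_finrank, pow_card_eq_one', AlgEquiv.one_apply]
  have hρθ' : ∀ n : ℕ, ((s ^ p ^ e) ^ n) θ = θ + n := by
    intro n
    induction n with
    | zero => simp
    | succ n ih => rw [pow_succ, AlgEquiv.mul_apply, hρθ, map_add, ih, map_one]; push_cast; ring
  have hρK' : ∀ (n : ℕ) (y : K), ((s ^ p ^ e) ^ n) (algebraMap K L y) = algebraMap K L y := by
    intro n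
    induction n with
    | zero => simp
    | succ n ih => intro y; rw [pow_succ, AlgEquiv.mul_apply, hρK, ih]
  have hord : orderOf s = p ^ (e + 1) := by
    refine orderOf_eq_prime_pow (fun h ↦ ?_) ?_
    · rw [h, AlgEquiv.one_apply] at hρθ
      simp at hρθ
    · rw [pow_succ, pow_mul]
      have hext : (((s ^ p ^ e) ^ p : L ≃ₐ[k] L) : L →+* L) = RingHom.id L := by
        refine AdjoinRoot.ringHom_ext (RingHom.ext fun y ↦ hρK' p y) ?_
        exact (hρθ' p).trans (by rw [CharP.cast_eq_zero, add_zero]; rfl)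
      exact AlgEquiv.ext fun x ↦ DFunLike.congr_fun hext x
  have hcard : Nat.card (L ≃ₐ[k] L) = Module.finrank k L := by
    refine le_antisymm ?_ ?_
    · rw [Nat.card_eq_fintype_card]; exact AlgEquiv.card_le
    · rw [hkL, ← hord]; exact orderOf_le_card
  exact ⟨L, inferInstance, inferInstance, inferInstance, inferInstance, hKL,
    IsGalois.of_card_aut_eq_finrank k L hcard,
    isCyclic_of_orderOf_eq_card s (by rw [hord, hcard, hkL]), θ, hθ⟩

theorem exists_zpow_of_ratFunc {Fq : Type*} [Field Fq] [Finite Fq]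
    (u : AbsoluteValue (RatFunc Fq) ℝ) (hna : IsNonarchimedean u) :
    ∃ g : ℝ, 0 < g ∧ ∀ x ≠ 0, ∃ l : ℤ, u x = g ^ l := by
  let P : Fq[X] → ℝ := fun f ↦ u (algebraMap Fq[X] (RatFunc Fq) f)
  have hP : ∀ f ≠ 0, 0 < P f := fun f hf ↦ u.pos (by simpa using hf)
  have hPmul : ∀ f h, P (f * h) = P f * P h := fun f h ↦ by simp [P]
  have hPpow : ∀ f (n : ℕ), P (f ^ n) = P f ^ n := fun f n ↦ by simp [P]
  have hPna : IsNonarchimedean P := fun f h ↦ by simpa [P] using hna _ _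
  have hPneg : ∀ f, P f = P (-f) := fun f ↦ by simp [P]
  have hC : ∀ a : Fq, a ≠ 0 → P (C a) = 1 := by
    intro a ha
    obtain ⟨n, hn, hn1⟩ := isOfFinOrder_iff_pow_eq_one.1 (isOfFinOrder_of_finite (Units.mk0 a ha))
    have h1 : a ^ n = 1 := by simpa using congrArg Units.val hn1
    have h2 : P (C a) ^ n = 1 := by rw [← hPpow, ← C_pow, h1]; simp [P]
    exact (pow_eq_one_iff_of_nonneg (u.nonneg _) hn.ne').1 h2
  have hCle : ∀ a : Fq, P (C a) ≤ 1 := fun a ↦ by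
    by_cases ha : a = 0
    · simp [P, ha]
    · exact (hC a ha).le
  suffices h : ∃ g : ℝ, 0 < g ∧ ∀ f ≠ 0, ∃ l : ℤ, P f = g ^ l by
    obtain ⟨g, hg, h⟩ := h
    refine ⟨g, hg, fun x hx ↦ ?_⟩
    obtain ⟨l, hl⟩ := h x.num (by simpa using hx)
    obtain ⟨l', hl'⟩ := h x.denom x.denom_ne_zero
    refine ⟨l - l', ?_⟩
    rw [zpow_sub₀ hg.ne', ← hl, ← hl', ← map_div₀, RatFunc.num_div_denom]
  rcases lt_or_ge 1 (P X) with hX | hX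
  · refine ⟨P X, by linarith, fun f hf ↦ ⟨f.natDegree, ?_⟩⟩
    have hlead : P (C f.leadingCoeff * X ^ f.natDegree) = P X ^ f.natDegree := by
      rw [hPmul, hPpow, hC _ (leadingCoeff_ne_zero.2 hf), one_mul]
    rw [zpow_natCast, ← hlead]
    conv_lhs => rw [f.as_sum_range_C_mul_X_pow]
    refine hPna.apply_sum_eq_of_lt hPneg (k := f.natDegree) (by simp) fun j hj hjk ↦ ?_
    change _ < P (C f.leadingCoeff * X ^ f.natDegree)
    rw [hlead, hPmul, hPpow]
    have hlt : j < f.natDegree := by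
      have := Finset.mem_range.1 hj
      omega
    calc P (C (f.coeff j)) * P X ^ j ≤ 1 * P X ^ j :=
          mul_le_mul_of_nonneg_right (hCle _) (pow_nonneg (u.nonneg _) _)
      _ < P X ^ f.natDegree := by rw [one_mul]; exact pow_lt_pow_right₀ hX hlt
  · have hle : ∀ f, P f ≤ 1 := by
      intro f
      rw [f.as_sum_range_C_mul_X_pow]
      refine (hPna.apply_sum_le_sup (by simp)).trans (Finset.sup'_le _ _ fun j _ ↦ ?_)
      rw [hPmul, hPpow]
      exact mul_le_one₀ (hCle _) (pow_nonneg (u.nonneg _) _) (pow_le_one₀ (u.nonneg _) hX)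
    by_cases hex : ∃ n, ∃ f : Fq[X], f ≠ 0 ∧ P f < 1 ∧ f.natDegree = n
    · classical
      obtain ⟨π, hπ0, hπ1, hπd⟩ := Nat.find_spec hex
      have hmin : ∀ f : Fq[X], f ≠ 0 → f.degree < π.degree → P f = 1 := by
        intro f hf hfd
        by_contra hne
        have := Nat.find_min' hex ⟨f, hf, (hle f).lt_of_ne hne, rfl⟩
        rw [← hπd] at this
        exact absurd (natDegree_lt_natDegree hf hfd) (by omega)
      refine ⟨P π, hP π hπ0, fun f ↦ ?_⟩
      induction hn : f.natDegree using Nat.strong_induction_on generalizing f with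
      | _ n ih =>
        intro hf
        have hdm := EuclideanDomain.mod_add_div f π
        by_cases hr : f % π = 0
        · rw [hr, zero_add] at hdm
          have hq : f / π ≠ 0 := fun h ↦ hf (by rw [← hdm, h, mul_zero])
          have hπpos : 0 < π.natDegree := by
            by_contra! h0
            rw [eq_C_of_natDegree_le_zero h0] at hπ1 hπ0
            exact hπ1.ne (hC _ fun h ↦ hπ0 (by rw [h, C_0]))
          obtain ⟨l, hl⟩ := ih (f / π).natDegree (by
            have := natDegree_mul hπ0 hq
            rw [hdm] at this
            omega) (f / π) rfl hq
          refine ⟨1 + l, ?_⟩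
          rw [zpow_add₀ (hP π hπ0).ne', zpow_one, ← hl, ← hPmul, hdm]
        · refine ⟨0, ?_⟩
          have h1 : P (f % π) = 1 := hmin _ hr (EuclideanDomain.mod_lt f hπ0)
          have h2 : P (π * (f / π)) < 1 := by
            rw [hPmul]
            exact mul_lt_one_of_nonneg_of_lt_one_left (u.nonneg _) hπ1 (hle _)
          rw [zpow_zero, ← hdm, hPna.add_eq_max_of_ne' _ hPneg (by rw [h1]; exact h2.ne'), h1,
            max_eq_left h2.le]
    · refine ⟨1, one_pos, fun f hf ↦ ⟨0, ?_⟩⟩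
      rw [zpow_zero]
      by_contra hne
      exact hex ⟨_, f, hf, (hle f).lt_of_ne hne, rfl⟩

theorem exists_pow_eq_apply_algebraMap {F E : Type*} [Field F] [Field E] [Algebra F E]
    [FiniteDimensional F E] (u : AbsoluteValue E ℝ) (hna : IsNonarchimedean u) {x : E}
    (hx : x ≠ 0) : ∃ j : ℕ, 0 < j ∧ j ≤ Module.finrank F E ∧ ∃ c : F, c ≠ 0 ∧
      u x ^ j = u (algebraMap F E c) := by
  have hdep : ¬ LinearIndependent F (fun i : Fin (Module.finrank F E + 1) ↦ x ^ (i : ℕ)) := by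
    intro h
    have := h.fintype_card_le_finrank
    simp at this
  obtain ⟨g, hsum, i₀, hi₀⟩ := Fintype.not_linearIndependent_iff.1 hdep
  obtain ⟨k, -, hk⟩ := Finset.univ.exists_max_image (fun i ↦ u (g i • x ^ (i : ℕ))) ⟨i₀, by simp⟩
  have hpos : 0 < u (g k • x ^ (k : ℕ)) :=
    (u.pos (smul_ne_zero hi₀ (pow_ne_zero _ hx))).trans_le (hk i₀ (by simp))
  have hj : ∃ j, j ≠ k ∧ u (g j • x ^ (j : ℕ)) = u (g k • x ^ (k : ℕ)) := by
    by_contra! hne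
    have := hna.apply_sum_eq_of_lt (fun a ↦ (u.map_neg a).symm) (Finset.mem_univ k)
      (fun j hj hjk ↦ (hk j hj).lt_of_ne (hne j hjk))
    rw [hsum, map_zero] at this
    exact hpos.ne this
  obtain ⟨j, hjk, hjeq⟩ := hj
  have hg : ∀ i, 0 < u (g i • x ^ (i : ℕ)) → g i ≠ 0 := by
    rintro i hi h
    simp [h] at hi
  have hux := u.pos hx
  have key : ∀ i j : Fin (Module.finrank F E + 1), i < j → g i ≠ 0 → g j ≠ 0 →
      u (g i • x ^ (i : ℕ)) = u (g j • x ^ (j : ℕ)) → ∃ j : ℕ, 0 < j ∧ j ≤ Module.finrank F E ∧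
        ∃ c : F, c ≠ 0 ∧ u x ^ j = u (algebraMap F E c) := by
    intro i j hij hi hj heq
    have hij' : (i : ℕ) < j := hij
    refine ⟨j - i, by omega, by omega, g i / g j, div_ne_zero hi hj, ?_⟩
    rw [Algebra.smul_def, Algebra.smul_def, map_mul, map_mul, map_pow, map_pow] at heq
    have hj' : u (algebraMap F E (g j)) ≠ 0 := by simpa using hj
    rw [map_div₀, map_div₀, eq_div_iff hj', ← mul_right_inj' (pow_pos hux i).ne', ← mul_assoc,
      ← pow_add, Nat.add_sub_cancel' hij'.le]
    linarith
  have hgk := hg k hpos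
  have hgj := hg j (hjeq ▸ hpos)
  rcases lt_or_gt_of_ne hjk with h | h
  · exact key j k h hgj hgk hjeq
  · exact key k j h hgk hgj hjeq.symm

theorem AbsoluteValue.IsNontrivial.comp_algebraMap {F E : Type*} [Field F] [Field E] [Algebra F E]
    [FiniteDimensional F E] {u : AbsoluteValue E ℝ} (hu : u.IsNontrivial)
    (hna : IsNonarchimedean u) : (u.comp (algebraMap F E).injective).IsNontrivial := by
  obtain ⟨x, hx, hx1⟩ := hu
  obtain ⟨j, hj, -, c, hc, hxc⟩ := exists_pow_eq_apply_algebraMap (F := F) u hna hx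
  refine ⟨c, hc, fun h ↦ hx1 ?_⟩
  have h' : u (algebraMap F E c) = 1 := h
  rw [h'] at hxc
  exact (pow_eq_one_iff_of_nonneg (u.nonneg x) hj.ne').1 hxc

theorem exists_forall_ne_pow {Fq k : Type*} [Field Fq] [Finite Fq] [Field k]
    [Algebra (RatFunc Fq) k] [FiniteDimensional (RatFunc Fq) k] {p : ℕ} (hp : 1 < p)
    (u : AbsoluteValue k ℝ) (hna : IsNonarchimedean u) (hu : u.IsNontrivial) :
    ∃ π : k, π ≠ 0 ∧ ∀ y, u π ≠ u y ^ p := by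
  by_contra! hall
  set d := Module.finrank (RatFunc Fq) k
  obtain ⟨g, hg, hgz⟩ := exists_zpow_of_ratFunc
    (u.comp (algebraMap (RatFunc Fq) k).injective) fun x y ↦ by
      have := hna (algebraMap _ k x) (algebraMap _ k y)
      rw [← map_add] at this
      exact this
  obtain ⟨t, ht, ht1⟩ := hu.comp_algebraMap (F := RatFunc Fq) hna
  obtain ⟨l₀, hl₀⟩ := hgz t ht
  rw [hl₀] at ht1
  have hg1 : g ≠ 1 := fun h ↦ ht1 (by rw [h, one_zpow])
  have hl₀0 : l₀ ≠ 0 := fun h ↦ ht1 (by rw [h, zpow_zero])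
  have ht' : algebraMap (RatFunc Fq) k t ≠ 0 := by simpa using ht
  have hroot : ∀ n : ℕ, ∃ y : k, y ≠ 0 ∧ u y ^ p ^ n = g ^ l₀ := by
    intro n
    induction n with
    | zero => exact ⟨algebraMap _ k t, ht', by rw [pow_zero, pow_one]; exact hl₀⟩
    | succ n ih =>
      obtain ⟨y, hy, hyn⟩ := ih
      obtain ⟨z, hz⟩ := hall y hy
      refine ⟨z, fun h ↦ (u.pos hy).ne' ?_, ?_⟩
      · rw [hz, h, map_zero, zero_pow (by omega)]
      · rw [pow_succ', pow_mul, ← hz, hyn]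
  obtain ⟨y, hy, hyn⟩ := hroot (l₀.natAbs * d)
  obtain ⟨j, hj, hjd, c, hc, hyc⟩ := exists_pow_eq_apply_algebraMap (F := RatFunc Fq) u hna hy
  obtain ⟨l, hl⟩ := hgz c hc
  have h1 : u y ^ j = g ^ l := hyc.trans hl
  have h2 : g ^ (l₀ * j) = g ^ (l * (p ^ (l₀.natAbs * d) : ℕ)) := by
    rw [zpow_mul, zpow_mul, ← h1, ← hyn, zpow_natCast, zpow_natCast, ← pow_mul, ← pow_mul,
      mul_comm]
  have h3 := zpow_right_injective₀ hg hg1 h2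
  have h4 : (p ^ (l₀.natAbs * d)) ∣ (l₀ * j).natAbs := by
    rw [← Int.natCast_dvd, h3]
    exact dvd_mul_left _ _
  have h5 := Nat.le_of_dvd (Int.natAbs_pos.2 (mul_ne_zero hl₀0 (by omega))) h4
  rw [Int.natAbs_mul, Int.natAbs_natCast] at h5
  have h6 := Nat.lt_pow_self hp (n := l₀.natAbs * d)
  exact (h6.trans_le h5).not_ge (Nat.mul_le_mul_left l₀.natAbs hjd)

theorem exists_forall_lt_and_ne_pow {k ι : Type*} [Field k] [Finite ι] {p : ℕ}
    (hk : ∀ u : AbsoluteValue k ℝ, u.IsNontrivial → ∃ π : k, π ≠ 0 ∧ ∀ y, u π ≠ u y ^ p)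
    (u : ι → AbsoluteValue k ℝ) (hna : ∀ v : AbsoluteValue k ℝ, IsNonarchimedean v)
    (hu : ∀ i, (u i).IsNontrivial) (hp : 0 < p) {B : ℝ} (hB : 1 ≤ B) :
    ∃ c : k, ∀ i, B < u i c ∧ ∀ y, u i c ≠ u i y ^ p := by
  let q : ι → Quotient (inferInstance : Setoid (AbsoluteValue k ℝ)) := fun i ↦ ⟦u i⟧
  let V : Set.range q → AbsoluteValue k ℝ := fun s ↦ s.1.out
  have hV : ∀ i, (V ⟨q i, i, rfl⟩).IsEquiv (u i) := fun i ↦ Quotient.mk_out (u i)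
  have hVnt : ∀ s, (V s).IsNontrivial := by
    rintro ⟨_, i, rfl⟩
    exact (hV i).isNontrivial_congr.2 (hu i)
  have hVp : Pairwise fun s t ↦ ¬ (V s).IsEquiv (V t) := by
    intro s t hst h
    exact hst (Subtype.ext (Quotient.out_equiv_out.1 h))
  have hc : ∀ s, ∃ c : k, (∀ i, q i = s.1 → B < u i c) ∧ ∀ y, V s c ≠ V s y ^ p := by
    intro s
    obtain ⟨π, hπ, hπp⟩ := hk (V s) (hVnt s)
    obtain ⟨t, ht⟩ := (hVnt s).exists_abv_gt_one
    have ht0 : t ≠ 0 := by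
      rintro rfl
      rw [map_zero] at ht
      linarith
    have hev : ∀ i, ∀ᶠ n : ℕ in Filter.atTop, q i = s.1 → B < u i (π * t ^ (p * n)) := by
      intro i
      by_cases hi : q i = s.1
      · obtain rfl : s = ⟨q i, i, rfl⟩ := Subtype.ext hi.symm
        have h1 : 1 < u i t ^ p := one_lt_pow₀ ((hV i).one_lt_iff.1 ht) hp.ne'
        have h2 := (tendsto_pow_atTop_atTop_of_one_lt h1).const_mul_atTop ((u i).pos hπ)
        filter_upwards [h2.eventually_gt_atTop B] with n hn _
        rwa [map_mul, map_pow, pow_mul]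
      · exact Filter.Eventually.of_forall fun n h ↦ absurd h hi
    obtain ⟨n, hn⟩ := (Filter.eventually_all.2 hev).exists
    refine ⟨π * t ^ (p * n), hn, fun y hy ↦ hπp (y / t ^ n) ?_⟩
    rw [map_mul, map_pow, mul_comm p n, pow_mul] at hy
    rw [map_div₀, map_pow, div_pow, ← hy,
      mul_div_cancel_right₀ _ (pow_ne_zero _ (pow_ne_zero _ ((V s).pos ht0).ne'))]
  choose c₀ hc₀ hc₀p using hc
  have := Fintype.ofFinite (Set.range q)
  obtain ⟨c, hcc⟩ := Metric.denseRange_iff.1 (AbsoluteValue.denseRange_algebraMap_pi hVnt hVp)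
    (fun s ↦ WithAbs.toAbs (V s) (c₀ s)) 1 one_pos
  rw [dist_pi_lt_iff one_pos] at hcc
  have hcc' : ∀ s, V s (c - c₀ s) < 1 := fun s ↦ by
    have := hcc s
    rw [dist_comm, dist_eq_norm] at this
    exact this
  have heq : ∀ s, V s c = V s (c₀ s) := by
    rintro ⟨_, i, rfl⟩
    set s : Set.range q := ⟨q i, i, rfl⟩
    have h1 : 1 < V s (c₀ s) := (hV i).one_lt_iff.2 (hB.trans_lt (hc₀ s i rfl))
    have h2 := (hna (V s)).add_eq_right_of_lt ((hcc' s).trans h1)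
    rwa [sub_add_cancel] at h2
  refine ⟨c, fun i ↦ ?_⟩
  rw [(hV i).eq_iff_eq.1 (heq ⟨q i, i, rfl⟩)]
  refine ⟨hc₀ _ i rfl, fun y hy ↦ hc₀p ⟨q i, i, rfl⟩ y ?_⟩
  rw [← map_pow] at hy ⊢
  exact (hV i).eq_iff_eq.2 hy

theorem AbsoluteValue.apply_pow_sub_self {K : Type*} [Field K] (v : AbsoluteValue K ℝ)
    (hna : IsNonarchimedean v) {p : ℕ} (hp : 1 < p) {y : K} (h : 1 < v (y ^ p - y)) :
    v (y ^ p - y) = v y ^ p := by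
  have hy : 1 < v y := by
    by_contra! hy
    have h1 := hna (y ^ p) (-y)
    rw [← sub_eq_add_neg, map_neg_eq_map, map_pow] at h1
    exact h.not_ge (h1.trans (max_le (pow_le_one₀ (v.nonneg y) hy) hy))
  have h1 : v (-y) < v (y ^ p) := by
    rw [map_neg_eq_map, map_pow]
    exact lt_self_pow₀ hy hp
  rw [sub_eq_add_neg, hna.add_eq_left_of_lt h1, map_pow]

theorem exists_cyclic_ext_of_degree_prime {k K ι : Type u} [Field k] [Field K] [Algebra k K]
    [FiniteDimensional k K] [IsGalois k K] [IsCyclic (K ≃ₐ[k] K)] [Finite ι] [Nonempty ι]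
    (p : ℕ) [Fact p.Prime] [CharP k p] {e : ℕ} (hdeg : Module.finrank k K = p ^ e)
    (hk : ∀ u : AbsoluteValue k ℝ, u.IsNontrivial → ∃ π : k, π ≠ 0 ∧ ∀ y, u π ≠ u y ^ p)
    (v : ι → AbsoluteValue K ℝ) (hv : ∀ i, (v i).IsNontrivial) :
    ∃ (L : Type u) (_ : Field L) (_ : Algebra k L) (_ : Algebra K L) (_ : IsScalarTower k K L),
      Module.finrank K L = p ∧ IsGalois k L ∧ IsCyclic (L ≃ₐ[k] L) ∧
      ∀ i, ExtendsUniquelyAV K L (v i) := by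
  have hp : p.Prime := Fact.out
  have : CharP K p := charP_of_injective_algebraMap (algebraMap k K).injective p
  have hnaK : ∀ v : AbsoluteValue K ℝ, IsNonarchimedean v :=
    AbsoluteValue.isNonarchimedean_of_charP p
  obtain ⟨σ, hσ⟩ := IsCyclic.exists_generator (α := K ≃ₐ[k] K)
  obtain ⟨a, b, ha, hb⟩ := exists_trace_eq_one_of_cyclic hσ p
  obtain ⟨B₀, hB₀⟩ := (Set.finite_range fun i ↦ v i b).bddAbove
  obtain ⟨c, hc⟩ := exists_forall_lt_and_ne_pow (p := p) (B := max 1 B₀) hk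
    (fun i ↦ (v i).comp (algebraMap k K).injective) (AbsoluteValue.isNonarchimedean_of_charP p)
    (fun i ↦ (hv i).comp_algebraMap (hnaK _)) hp.pos (le_max_left _ _)
  have hc1 : ∀ i, 1 < v i (algebraMap k K c) := fun i ↦ (le_max_left _ _).trans_lt (hc i).1
  have hcp : ∀ i (y : k), v i (algebraMap k K c) ≠ v i (algebraMap k K y) ^ p := fun i ↦ (hc i).2
  have hcb : ∀ i, v i (b + algebraMap k K c) = v i (algebraMap k K c) := fun i ↦
    (hnaK (v i)).add_eq_right_of_lt
      ((hB₀ ⟨i, rfl⟩).trans_lt ((le_max_right _ _).trans_lt (hc i).1))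
  have hβ : σ (b + algebraMap k K c) - (b + algebraMap k K c) = a ^ p - a := by
    rw [map_add, AlgEquiv.commutes, ← hb]
    ring
  have hroot : ∀ y : K, y ^ p - y ≠ b + algebraMap k K c := by
    intro y hy
    rcases e.eq_zero_or_pos with rfl | he
    · rw [pow_zero] at hdeg
      obtain ⟨i⟩ := ‹Nonempty ι›
      obtain ⟨y, rfl⟩ := Algebra.surjective_algebraMap_iff.2
        (Subalgebra.bot_eq_top_iff_finrank_eq_one.2 hdeg).symm y
      have h1 := hcb i
      rw [← hy] at h1
      have h2 := (v i).apply_pow_sub_self (hnaK _) hp.one_lt (h1 ▸ hc1 i)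
      exact hcp i y (h1.symm.trans h2)
    · have hh : (σ y - y - a) ∈ (⊥ : Subfield K) := by
        rw [Subfield.mem_bot_iff_pow_eq_self K p, sub_pow_char, sub_pow_char]
        rw [← hy, map_sub, map_pow] at hβ
        linear_combination hβ
      obtain ⟨n, hn⟩ := (mem_bot_iff_intCast p K).1 hh
      have htr := congrArg (Algebra.trace k K) hn
      rw [map_sub, map_sub, Algebra.trace_eq_of_algEquiv, sub_self, ha, zero_sub,
        ← map_intCast (algebraMap k K), Algebra.trace_algebraMap, hdeg, nsmul_eq_mul, Nat.cast_pow,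
        CharP.cast_eq_zero, zero_pow he.ne', zero_mul] at htr
      simp at htr
  obtain ⟨L, _, _, _, _, hKL, hgal, hcyc, θ, hθ⟩ :=
    exists_cyclic_artinSchreier hσ p hdeg ha hβ hroot
  refine ⟨L, ‹_›, ‹_›, ‹_›, ‹_›, hKL, hgal, hcyc, fun i ↦ ?_⟩
  have : FiniteDimensional K L := FiniteDimensional.of_finrank_pos (hKL ▸ hp.pos)
  have : FiniteDimensional k L := FiniteDimensional.trans k K L
  have : IsGalois K L := IsGalois.tower_top_of_isGalois k K L
  have : CharP L p := charP_of_injective_algebraMap (algebraMap K L).injective p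
  have hkL : Module.finrank k L = p ^ (e + 1) := by
    rw [← Module.finrank_mul_finrank k K L, hdeg, hKL, pow_succ]
  have hfix : ∀ w : AbsoluteValue L ℝ, ExtendsAV (v i) w → ∀ (τ : L ≃ₐ[K] L) x,
      w (τ x) = w x := by
    intro w hw
    have hnaL := AbsoluteValue.isNonarchimedean_of_charP p w
    refine apply_eq_of_exists_ne_one hp hkL hKL w ?_
    by_contra! hst
    have hwθ : w (θ ^ p - θ) = v i (algebraMap k K c) := by rw [hθ, hw, hcb]
    have hwθp := w.apply_pow_sub_self hnaL hp.one_lt (hwθ ▸ hc1 i)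
    have hθ0 : θ ≠ 0 := by
      rintro rfl
      rw [zero_pow hp.ne_zero, sub_zero, map_zero] at hwθ
      linarith [hc1 i]
    obtain ⟨y, hy⟩ := exists_norm_sub_algebraMap_lt w hnaL (hw.isNontrivial (hv i)) hst θ
      (w.pos hθ0)
    have h1 := hnaL.add_eq_right_of_lt hy
    rw [sub_add_cancel, IsScalarTower.algebraMap_apply k K L, hw] at h1
    exact hcp i y (by rw [← hwθ, hwθp, h1])
  exact ⟨exists_extendsAV (v i) (hnaK _) (hv i), fun w w' hw hw' ↦
    eq_of_extendsAV_of_forall_apply_eq hw hw' (hfix w hw) (hfix w' hw')⟩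

theorem ExtendsUniquelyAV.trans {K L M : Type*} [Field K] [Field L] [Field M] [Algebra K L]
    [Algebra L M] [Algebra K M] [IsScalarTower K L M] {v : AbsoluteValue K ℝ}
    {w : AbsoluteValue L ℝ} (h : ExtendsUniquelyAV K L v) (hw : ExtendsAV v w)
    (h' : ExtendsUniquelyAV L M w) : ExtendsUniquelyAV K M v := by
  have hres : ∀ z : AbsoluteValue M ℝ, ExtendsAV v z → ExtendsAV w z := by
    intro z hz x
    have hz' : ExtendsAV v (z.comp (algebraMap L M).injective) := fun y ↦ by
      rw [← hz y, IsScalarTower.algebraMap_apply K L M]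
      rfl
    rw [← h.2 _ _ hz' hw]
    rfl
  obtain ⟨⟨z, hz⟩, huniq⟩ := h'
  refine ⟨⟨z, fun x ↦ ?_⟩, fun z z' hz hz' ↦ huniq z z' (hres z hz) (hres z' hz')⟩
  rw [IsScalarTower.algebraMap_apply K L M, hz, hw]

theorem exists_cyclic_ext_of_degree_prime_pow {k K ι : Type u} [Field k] [Field K] [Algebra k K]
    [FiniteDimensional k K] [IsGalois k K] [IsCyclic (K ≃ₐ[k] K)] [Finite ι] [Nonempty ι]
    (p : ℕ) [Fact p.Prime] [CharP k p] {e : ℕ} (hdeg : Module.finrank k K = p ^ e)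
    (hk : ∀ u : AbsoluteValue k ℝ, u.IsNontrivial → ∃ π : k, π ≠ 0 ∧ ∀ y, u π ≠ u y ^ p)
    (v : ι → AbsoluteValue K ℝ) (hv : ∀ i, (v i).IsNontrivial) (m : ℕ) :
    ∃ (L : Type u) (_ : Field L) (_ : Algebra k L) (_ : Algebra K L) (_ : IsScalarTower k K L),
      Module.finrank K L = p ^ m ∧ IsGalois k L ∧ IsCyclic (L ≃ₐ[k] L) ∧
      ∀ i, ExtendsUniquelyAV K L (v i) := by
  have hp : p.Prime := Fact.out
  induction m with
  | zero =>
    refine ⟨K, inferInstance, inferInstance, inferInstance, inferInstance, by simp, inferInstance,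
      inferInstance, fun i ↦ ⟨⟨v i, fun x ↦ rfl⟩, fun w w' hw hw' ↦ ?_⟩⟩
    ext x
    exact (hw x).trans (hw' x).symm
  | succ m ih =>
    obtain ⟨L, _, _, _, _, hKL, hgal, hcyc, hL⟩ := ih
    have : FiniteDimensional K L := FiniteDimensional.of_finrank_pos (hKL ▸ pow_pos hp.pos m)
    have : FiniteDimensional k L := FiniteDimensional.trans k K L
    have hkL : Module.finrank k L = p ^ (e + m) := by
      rw [← Module.finrank_mul_finrank k K L, hdeg, hKL, pow_add]
    choose w hw using fun i ↦ (hL i).1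
    obtain ⟨M, _, _, _, _, hLM, hgal', hcyc', hM⟩ := exists_cyclic_ext_of_degree_prime p hkL hk w
      fun i ↦ (hw i).isNontrivial (hv i)
    let : Algebra K M := ((algebraMap L M).comp (algebraMap K L)).toAlgebra
    have : IsScalarTower K L M := IsScalarTower.of_algebraMap_eq fun _ ↦ rfl
    have : IsScalarTower k K M := IsScalarTower.of_algebraMap_eq fun x ↦ by
      rw [IsScalarTower.algebraMap_apply K L M, ← IsScalarTower.algebraMap_apply k K L,
        ← IsScalarTower.algebraMap_apply k L M]
    refine ⟨M, ‹_›, ‹_›, ‹_›, ‹_›, ?_, hgal', hcyc', fun i ↦ (hL i).trans (hw i) (hM i)⟩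
    rw [← Module.finrank_mul_finrank K L M, hKL, hLM, pow_succ]

theorem exists_isNontrivial_absoluteValue_ratFunc (Fq : Type*) [Field Fq] :
    ∃ u : AbsoluteValue (RatFunc Fq) ℝ, IsNonarchimedean u ∧ u.IsNontrivial := by
  let P : IsDedekindDomain.HeightOneSpectrum Fq[X] :=
    ⟨Ideal.span {X}, (Ideal.span_singleton_prime X_ne_zero).2 prime_X, by simp⟩
  refine ⟨P.adicAbv (K := RatFunc Fq) (b := 2) one_lt_two, P.isNonarchimedean_adicAbv _,
    algebraMap Fq[X] _ X, by simp [RatFunc.X_ne_zero], ?_⟩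
  exact ((P.adicAbv_coe_lt_one_iff _ _).2 (Ideal.mem_span_singleton_self X)).ne

/-- Let `K/k` be a cyclic extension of `p`-power degree of global fields
with `char k = p > 0`, and let `v 0, …, v (r-1)` be pairwise different valuations on `K`.
For any `m ∈ ℕ` there exists a field extension `L ⊇ K` with `[L:K] = p^m` such that `L/k`
is cyclic and the local degree `[L:K]_{v i}` equals `p^m` for each `i` (in particular
each `v i` extends uniquely to `L`). -/
theorem stmt7 {k K : Type u} [Field k] [Field K] [Algebra k K]
    (p : ℕ) (hp : p.Prime) [CharP k p] (hk : IsGlobalField k)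
    [FiniteDimensional k K] [IsGalois k K] [IsCyclic (K ≃ₐ[k] K)]
    (e : ℕ) (hdeg : Module.finrank k K = p ^ e)
    (r : ℕ) (v : Fin r → AbsoluteValue K ℝ)
    (hnt : ∀ i, IsNontrivialAV (v i))
    (hpair : ∀ i j, i ≠ j → ¬ EquivAV (v i) (v j))
    (m : ℕ) (hm : 1 ≤ m) :
    ∃ (L : Type u) (_ : Field L) (_ : Algebra k L) (_ : Algebra K L)
      (_ : IsScalarTower k K L),
      Module.finrank K L = p ^ m ∧ IsGalois k L ∧ IsCyclic (L ≃ₐ[k] L) ∧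
      ∀ i : Fin r,
        ExtendsUniquelyAV K L (v i) ∧
        ∀ w : AbsoluteValue L ℝ, ExtendsAV (v i) w →
          localDegreeGal K w = p ^ m := by
  have := Fact.mk hp
  have hnaK : ∀ v : AbsoluteValue K ℝ, IsNonarchimedean v :=
    have := charP_of_injective_algebraMap (algebraMap k K).injective p
    AbsoluteValue.isNonarchimedean_of_charP p
  rcases hk with hk | ⟨Fq, _, _, _, _⟩
  · exact absurd (CharP.eq k ‹CharP k p› (CharP.ofCharZero k)) hp.ne_zero
  have hpow : ∀ u : AbsoluteValue k ℝ, u.IsNontrivial → ∃ π : k, π ≠ 0 ∧ ∀ y, u π ≠ u y ^ p :=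
    fun u hu ↦ exists_forall_ne_pow (Fq := Fq) hp.one_lt u
      (AbsoluteValue.isNonarchimedean_of_charP p u) hu
  obtain ⟨u, hu, hu'⟩ := exists_isNontrivial_absoluteValue_ratFunc Fq
  obtain ⟨u₁, hu₁⟩ := exists_extendsAV (L := k) u hu hu'
  obtain ⟨u₂, hu₂⟩ := exists_extendsAV (L := K) u₁ (AbsoluteValue.isNonarchimedean_of_charP p u₁)
    (hu₁.isNontrivial hu')
  let v' : ULift.{u} (Option (Fin r)) → AbsoluteValue K ℝ := fun i ↦ i.down.elim u₂ v
  have hv' : ∀ i, (v' i).IsNontrivial := by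
    rintro ⟨_ | i⟩
    · exact hu₂.isNontrivial (hu₁.isNontrivial hu')
    · exact hnt i
  obtain ⟨L, _, _, _, _, hKL, hgal, hcyc, hL⟩ :=
    exists_cyclic_ext_of_degree_prime_pow p hdeg hpow v' hv' m
  have hLv : ∀ i, ExtendsUniquelyAV K L (v i) := fun i ↦ hL ⟨some i⟩
  refine ⟨L, ‹_›, ‹_›, ‹_›, ‹_›, hKL, hgal, hcyc, fun i ↦ ⟨hLv i, fun w hw ↦ ?_⟩⟩
  have : FiniteDimensional K L := FiniteDimensional.of_finrank_pos (hKL ▸ pow_pos hp.pos m)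
  have : IsGalois K L := IsGalois.tower_top_of_isGalois k K L
  have hfix : ∀ (σ : L ≃ₐ[K] L) x, w (σ x) = w x := by
    intro σ x
    have hσ : ExtendsAV (v i) (w.comp (f := (σ : L →+* L)) σ.injective) := fun y ↦ by
      rw [← hw y]
      exact congrArg w (σ.commutes y)
    exact DFunLike.congr_fun ((hLv i).2 _ _ hσ hw) x
  rw [localDegreeGal, ← hKL, ← IsGalois.card_aut_eq_finrank K L]
  exact Nat.card_congr (Equiv.subtypeUnivEquiv hfix)
end
end
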